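/- In the binary case with i.i.d. fair coin flips, for every k \ge 1, the standardized even moments satisfy \lim_{n\to\infty} \mu_{2k}(n)/\sigma(n)^{2k} = (2k)!/(2^k k!) = 1·3·5···(2k-1), and all odd moments vanish; consequently S/\sigma(n) converges in distribution to a standard normal. -/

import Mathlib

open Finset

/-- Kendall score S = S⁺ - S⁻ of a finite sequence: S⁺ counts the pairs of positions in which
the earlier element exceeds the later one, S⁻ those in which the earlier element is smaller
(the paper's convention: S(0 1 1 2 0 2 1) = 5 - 11 = -6). -/
def kendallS {n : ℕ} {α : Type*} [LinearOrder α] (x : Fin n → α) : ℤ :=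
  ((Finset.univ.filter (fun p : Fin n × Fin n => p.2 < p.1 ∧ x p.1 < x p.2)).card : ℤ) -
  ((Finset.univ.filter (fun p : Fin n × Fin n => p.2 < p.1 ∧ x p.2 < x p.1)).card : ℤ)
open scoped BigOperators

/-- σ(n): the standard deviation of S for n fair coin flips, σ(n)² = μ₂(n) = E[S²]. -/
noncomputable def kendallSigma (n : ℕ) : ℝ :=
  Real.sqrt ((∑ x : Fin n → Fin 2, (kendallS x : ℝ) ^ 2) / 2 ^ n)

section KendallLimit

open MeasureTheory ProbabilityTheory Filter Topology

/-- The sign `±1` attached to a bit. -/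
def bitSign (b : Fin 2) : ℝ := 2 * (b : ℝ) - 1

/-- The weight of position `i` in the Kendall score of a binary sequence of length `n`. -/
noncomputable def kendallWeight (n : ℕ) (i : Fin n) : ℝ := ((n : ℝ) - 1 - 2 * i) / 2

lemma sum_range_sub_two_mul (c : ℝ) (m : ℕ) :
    ∑ i ∈ range m, (c - 2 * i) = m * c - m * (m - 1) := by
  induction m with
  | zero => simp
  | succ m ih => rw [sum_range_succ, ih]; push_cast; ring

lemma sum_range_sub_two_mul_sq (c : ℝ) (m : ℕ) :
    ∑ i ∈ range m, (c - 2 * i) ^ 2 =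
      m * c ^ 2 - 2 * c * m * (m - 1) + 2 / 3 * m * (m - 1) * (2 * m - 1) := by
  induction m with
  | zero => simp
  | succ m ih => rw [sum_range_succ, ih]; push_cast; ring

lemma sum_kendallWeight (n : ℕ) : ∑ i, kendallWeight n i = 0 := by
  simp only [kendallWeight]
  rw [← Finset.sum_div, Fin.sum_univ_eq_sum_range (fun i : ℕ => (n : ℝ) - 1 - 2 * i),
    sum_range_sub_two_mul]
  ring

lemma sum_kendallWeight_sq (n : ℕ) :
    ∑ i, kendallWeight n i ^ 2 = ((n : ℝ) ^ 3 - n) / 12 := by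
  simp only [kendallWeight, div_pow]
  rw [← Finset.sum_div, Fin.sum_univ_eq_sum_range (fun i : ℕ => ((n : ℝ) - 1 - 2 * i) ^ 2),
    sum_range_sub_two_mul_sq]
  ring

lemma kendallWeight_sq_le (n : ℕ) (i : Fin n) : kendallWeight n i ^ 2 ≤ (n : ℝ) ^ 2 / 4 := by
  have h : ((i : ℕ) : ℝ) + 1 ≤ n := by exact_mod_cast i.2
  have h0 : (0 : ℝ) ≤ (i : ℕ) := by positivity
  rw [kendallWeight, div_pow]
  nlinarith

lemma kendallS_eq_sum {n : ℕ} (x : Fin n → Fin 2) :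
    (kendallS x : ℝ) = ∑ i, kendallWeight n i * bitSign (x i) := by
  have key : ∀ a b : Fin 2, ((if a < b then 1 else 0 : ℝ) - if b < a then 1 else 0) =
      (b : ℝ) - (a : ℝ) := by
    intro a b; fin_cases a <;> fin_cases b <;> simp
  have h1 : (kendallS x : ℝ) =
      ∑ i : Fin n, ∑ j : Fin n, if j < i then ((x j : ℝ) - (x i : ℝ)) else 0 := by
    rw [kendallS, ← Fintype.sum_prod_type']
    simp only [Finset.card_filter]
    push_cast
    rw [← Finset.sum_sub_distrib]
    refine Finset.sum_congr rfl fun p _ => ?_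
    rw [← key]
    by_cases hp : p.2 < p.1 <;> simp [hp]
  have h2 : ∀ j : Fin n, ∑ i : Fin n, (if j < i then (x j : ℝ) else 0) =
      ((n : ℝ) - 1 - j) * x j := by
    intro j
    rw [← Finset.sum_filter, Finset.sum_const, Finset.filter_lt_eq_Ioi, Fin.card_Ioi, nsmul_eq_mul]
    have := j.2
    rw [Nat.cast_sub (by omega), Nat.cast_sub (by omega)]
    simp
  have h3 : ∀ i : Fin n, ∑ j : Fin n, (if j < i then (x i : ℝ) else 0) = (i : ℝ) * x i := by
    intro i
    rw [← Finset.sum_filter, Finset.sum_const, Finset.filter_gt_eq_Iio, Fin.card_Iio, nsmul_eq_mul]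
  have h4 : (kendallS x : ℝ) = ∑ i, 2 * kendallWeight n i * (x i : ℝ) := by
    rw [h1]
    have : ∀ i j : Fin n, (if j < i then ((x j : ℝ) - (x i : ℝ)) else 0) =
        (if j < i then (x j : ℝ) else 0) - if j < i then (x i : ℝ) else 0 := by
      intro i j; split_ifs <;> simp
    simp only [this, Finset.sum_sub_distrib, h3]
    rw [Finset.sum_comm]
    simp only [h2]
    rw [← Finset.sum_sub_distrib]
    refine Finset.sum_congr rfl fun i _ => ?_
    rw [kendallWeight]; ring
  have h5 : ∑ i, kendallWeight n i * bitSign (x i) =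
      ∑ i, 2 * kendallWeight n i * (x i : ℝ) - ∑ i, kendallWeight n i := by
    rw [← Finset.sum_sub_distrib]
    refine Finset.sum_congr rfl fun i _ => ?_
    rw [bitSign]; ring
  rw [h5, sum_kendallWeight, h4, sub_zero]

lemma sum_bits_cons {M : Type*} [AddCommMonoid M] (n : ℕ) (f : (Fin (n + 1) → Fin 2) → M) :
    ∑ x, f x = ∑ y : Fin n → Fin 2, (f (Fin.cons 0 y) + f (Fin.cons 1 y)) := by
  rw [← (Fin.consEquiv fun _ : Fin (n + 1) => Fin 2).sum_comp, Fintype.sum_prod_type,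
    Fin.sum_univ_two, ← Finset.sum_add_distrib]
  rfl

lemma sum_bits_sq (n : ℕ) (a : Fin n → ℝ) :
    ∑ x : Fin n → Fin 2, (∑ i, a i * bitSign (x i)) ^ 2 = 2 ^ n * ∑ i, a i ^ 2 := by
  induction n with
  | zero => simp
  | succ n ih =>
    have h := ih (fun i => a i.succ)
    rw [sum_bits_cons]
    simp only [Fin.sum_univ_succ, Fin.cons_zero, Fin.cons_succ]
    have e : ∀ y : Fin n → Fin 2,
        (a 0 * bitSign 0 + ∑ i : Fin n, a i.succ * bitSign (y i)) ^ 2 +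
        (a 0 * bitSign 1 + ∑ i : Fin n, a i.succ * bitSign (y i)) ^ 2 =
        2 * a 0 ^ 2 + 2 * (∑ i : Fin n, a i.succ * bitSign (y i)) ^ 2 := by
      intro y; simp only [bitSign]; norm_num; ring
    simp only [e, Finset.sum_add_distrib, ← Finset.mul_sum, h]
    simp
    ring

lemma sum_bits_cexp (n : ℕ) (a : Fin n → ℝ) (z : ℂ) :
    ∑ x : Fin n → Fin 2, Complex.exp (z * ((∑ i, a i * bitSign (x i) : ℝ) : ℂ)) =
      2 ^ n * ∏ i, Complex.cosh (z * a i) := by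
  induction n with
  | zero => simp
  | succ n ih =>
    have h := ih (fun i => a i.succ)
    rw [sum_bits_cons]
    simp only [Fin.sum_univ_succ, Fin.prod_univ_succ, Fin.cons_zero, Fin.cons_succ,
      Complex.ofReal_add, mul_add, Complex.exp_add, ← add_mul, ← Finset.mul_sum, h]
    rw [Complex.cosh]
    simp only [bitSign]
    norm_num
    ring

lemma kendallSigma_sq (n : ℕ) : kendallSigma n ^ 2 = ((n : ℝ) ^ 3 - n) / 12 := by
  rw [kendallSigma, Real.sq_sqrt (by positivity)]
  simp only [kendallS_eq_sum]
  rw [sum_bits_sq, sum_kendallWeight_sq]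
  field_simp

lemma kendallS_rev {n : ℕ} (x : Fin n → Fin 2) :
    kendallS (fun i => Fin.rev (x i)) = -kendallS x := by
  simp [kendallS]

lemma sum_kendallS_odd (k n : ℕ) :
    ∑ x : Fin n → Fin 2, (kendallS x : ℝ) ^ (2 * k + 1) = 0 := by
  have h := (Equiv.arrowCongr (Equiv.refl (Fin n)) (Fin.revPerm : Equiv.Perm (Fin 2))).sum_comp
    fun x => (kendallS x : ℝ) ^ (2 * k + 1)
  have e : ∀ x : Fin n → Fin 2,
      Equiv.arrowCongr (Equiv.refl (Fin n)) (Fin.revPerm : Equiv.Perm (Fin 2)) x =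
        fun i => Fin.rev (x i) := fun x => rfl
  simp only [e, kendallS_rev, Int.cast_neg, (odd_two_mul_add_one k).neg_pow,
    Finset.sum_neg_distrib] at h
  linarith

lemma abs_prod_sub_prod_le {ι : Type*} (s : Finset ι) (f g : ι → ℝ)
    (hf : ∀ i ∈ s, |f i| ≤ 1) (hg : ∀ i ∈ s, |g i| ≤ 1) :
    |∏ i ∈ s, f i - ∏ i ∈ s, g i| ≤ ∑ i ∈ s, |f i - g i| := by
  classical
  induction s using Finset.induction_on with
  | empty => simp
  | insert a s ha ih =>
    rw [prod_insert ha, prod_insert ha, sum_insert ha]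
    have ih' := ih (fun i hi => hf i (mem_insert_of_mem hi)) fun i hi => hg i (mem_insert_of_mem hi)
    have hP : |∏ i ∈ s, f i| ≤ 1 := by
      rw [abs_prod]
      exact prod_le_one (fun _ _ => abs_nonneg _) fun i hi => hf i (mem_insert_of_mem hi)
    calc |f a * ∏ i ∈ s, f i - g a * ∏ i ∈ s, g i|
        = |(f a - g a) * ∏ i ∈ s, f i + g a * (∏ i ∈ s, f i - ∏ i ∈ s, g i)| := by ring_nf
      _ ≤ |f a - g a| * |∏ i ∈ s, f i| + |g a| * |∏ i ∈ s, f i - ∏ i ∈ s, g i| := by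
          rw [← abs_mul, ← abs_mul]; exact abs_add_le _ _
      _ ≤ |f a - g a| * 1 + 1 * ∑ i ∈ s, |f i - g i| := by
          gcongr
          exact hg a (mem_insert_self a s)
      _ = _ := by ring

lemma abs_cos_sub_exp_le {u : ℝ} (hu : |u| ≤ 1) :
    |Real.cos u - Real.exp (-(u ^ 2 / 2))| ≤ u ^ 4 := by
  have h1 := Real.cos_bound hu
  have hu2 : u ^ 2 ≤ 1 := by rw [← sq_abs]; exact pow_le_one₀ (abs_nonneg _) hu
  have h2 := Real.abs_exp_sub_one_sub_id_le (x := -(u ^ 2 / 2)) (by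
    rw [abs_neg, abs_of_nonneg (by positivity)]; linarith)
  rw [show |u| ^ 4 = u ^ 4 by rw [← abs_pow, abs_of_nonneg (by positivity)]] at h1
  rw [abs_le] at *
  constructor <;> nlinarith [h1.1, h1.2, h2.1, h2.2, sq_nonneg (u ^ 2)]

/-- Lindeberg-type estimate for a product of cosines. -/
lemma abs_prod_cos_sub_exp_le {ι : Type*} [Fintype ι] (u : ι → ℝ) {δ : ℝ} (hδ : δ ≤ 1)
    (hu : ∀ i, u i ^ 2 ≤ δ) :
    |∏ i, Real.cos (u i) - Real.exp (-((∑ i, u i ^ 2) / 2))| ≤ δ * ∑ i, u i ^ 2 := by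
  rw [Finset.sum_div, ← Finset.sum_neg_distrib, Real.exp_sum, Finset.mul_sum]
  refine (abs_prod_sub_prod_le _ _ _ (fun i _ => Real.abs_cos_le_one _) fun i _ => ?_).trans
    (Finset.sum_le_sum fun i _ => ?_)
  · rw [Real.abs_exp, Real.exp_le_one_iff]
    have := sq_nonneg (u i)
    linarith
  · refine (abs_cos_sub_exp_le ?_).trans ?_
    · rw [← sq_le_one_iff_abs_le_one]; exact (hu i).trans hδ
    · nlinarith [hu i, sq_nonneg (u i)]

/-- The law of `S / σ(n)` for `n` fair coin flips. -/
noncomputable def kendallLaw (n : ℕ) : ProbabilityMeasure ℝ :=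
  ⟨(PMF.uniformOfFintype (Fin n → Fin 2)).toMeasure.map
    fun x => (kendallS x : ℝ) / kendallSigma n,
    Measure.isProbabilityMeasure_map (measurable_of_finite _).aemeasurable⟩

lemma integrable_kendallLaw {E : Type*} [NormedAddCommGroup E] (n : ℕ) {f : ℝ → E}
    (hf : Continuous f) [SecondCountableTopologyEither ℝ E] :
    Integrable f (kendallLaw n : Measure ℝ) := by
  refine (integrable_map_measure hf.aestronglyMeasurable
    (measurable_of_finite _).aemeasurable).2 ?_
  exact Integrable.of_finite

lemma integral_kendallLaw {E : Type*} [NormedAddCommGroup E] [NormedSpace ℝ E] [CompleteSpace E]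
    (n : ℕ) {f : ℝ → E} (hf : Continuous f) :
    ∫ y, f y ∂(kendallLaw n : Measure ℝ) =
      ((2 : ℝ) ^ n)⁻¹ • ∑ x : Fin n → Fin 2, f ((kendallS x : ℝ) / kendallSigma n) := by
  have h : (kendallLaw n : Measure ℝ) = (PMF.uniformOfFintype (Fin n → Fin 2)).toMeasure.map
    fun x => (kendallS x : ℝ) / kendallSigma n := rfl
  rw [h, integral_map (measurable_of_finite _).aemeasurable hf.aestronglyMeasurable,
    PMF.integral_eq_sum, Finset.smul_sum]
  refine Finset.sum_congr rfl fun x _ => ?_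
  simp

lemma kendallS_div_sigma {n : ℕ} (x : Fin n → Fin 2) :
    (kendallS x : ℝ) / kendallSigma n =
      ∑ i, kendallWeight n i / kendallSigma n * bitSign (x i) := by
  rw [kendallS_eq_sum, Finset.sum_div]
  exact Finset.sum_congr rfl fun i _ => by ring

lemma sum_kendallWeight_div_sq {n : ℕ} (hn : 2 ≤ n) :
    ∑ i, (kendallWeight n i / kendallSigma n) ^ 2 = 1 := by
  have : (2 : ℝ) ≤ n := by exact_mod_cast hn
  simp only [div_pow]
  rw [← Finset.sum_div, sum_kendallWeight_sq, kendallSigma_sq, div_self]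
  have : (0 : ℝ) < n ^ 3 - n := by
    rw [show (n : ℝ) ^ 3 - n = n * (n - 1) * (n + 1) by ring]
    have : (0 : ℝ) < n - 1 := by linarith
    positivity
  positivity

lemma kendallWeight_div_sq_le {n : ℕ} (hn : 2 ≤ n) (i : Fin n) :
    (kendallWeight n i / kendallSigma n) ^ 2 ≤ 6 / n := by
  have h2 : (2 : ℝ) ≤ n := by exact_mod_cast hn
  have h3 : (0 : ℝ) < n ^ 3 - n := by
    rw [show (n : ℝ) ^ 3 - n = n * (n - 1) * (n + 1) by ring]
    have : (0 : ℝ) < n - 1 := by linarith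
    positivity
  rw [div_pow, kendallSigma_sq, div_le_div_iff₀ (by positivity) (by positivity)]
  have := mul_le_mul_of_nonneg_right (kendallWeight_sq_le n i) (by positivity : (0 : ℝ) ≤ n)
  nlinarith [mul_nonneg (by linarith : (0 : ℝ) ≤ n) (by nlinarith : (0 : ℝ) ≤ (n : ℝ) ^ 2 - 2)]

lemma integral_cexp_kendallLaw (n : ℕ) (z : ℂ) :
    ∫ y : ℝ, Complex.exp (z * y) ∂(kendallLaw n : Measure ℝ) =
      ∏ i, Complex.cosh (z * (kendallWeight n i / kendallSigma n : ℝ)) := by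
  rw [integral_kendallLaw n (by fun_prop)]
  simp only [kendallS_div_sigma]
  rw [sum_bits_cexp n _ z, Complex.real_smul]
  push_cast
  field_simp

lemma charFun_kendallLaw (n : ℕ) (t : ℝ) :
    charFun (kendallLaw n : Measure ℝ) t =
      ((∏ i, Real.cos (t * (kendallWeight n i / kendallSigma n)) : ℝ) : ℂ) := by
  rw [charFun_apply_real]
  have h := integral_cexp_kendallLaw n (t * Complex.I)
  push_cast
  convert h using 2
  · ext y; congr 1; ring
  · rw [← Complex.cosh_mul_I]; congr 1; push_cast; ring

lemma integral_cosh_kendallLaw_le {n : ℕ} (hn : 2 ≤ n) :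
    ∫ y, Real.cosh y ∂(kendallLaw n : Measure ℝ) ≤ Real.exp (1 / 2) := by
  have hexp (s : ℝ) : ∫ y, Real.exp (s * y) ∂(kendallLaw n : Measure ℝ) =
      ∏ i, Real.cosh (s * (kendallWeight n i / kendallSigma n)) := by
    have h := integral_cexp_kendallLaw n s
    have e : ∀ y : ℝ, Complex.exp (s * y) = ((Real.exp (s * y) : ℝ) : ℂ) := by
      intro y; push_cast; rfl
    simp only [e] at h
    rw [integral_complex_ofReal] at h
    exact_mod_cast h
  have h1 := hexp 1
  have h2 := hexp (-1)
  simp only [one_mul, neg_one_mul, Real.cosh_neg] at h1 h2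
  have h3 : ∫ y, Real.cosh y ∂(kendallLaw n : Measure ℝ) =
      ∏ i, Real.cosh (kendallWeight n i / kendallSigma n) := by
    simp only [Real.cosh_eq]
    rw [integral_div, integral_add (integrable_kendallLaw n (by fun_prop))
      (integrable_kendallLaw n (by fun_prop)), h1, h2]
    simp only [Real.cosh_eq]
    ring
  rw [h3]
  calc ∏ i, Real.cosh (kendallWeight n i / kendallSigma n)
      ≤ ∏ i, Real.exp ((kendallWeight n i / kendallSigma n) ^ 2 / 2) :=
        Finset.prod_le_prod (fun i _ => (Real.cosh_pos _).le) fun i _ => Real.cosh_le_exp_half_sq _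
    _ = Real.exp (1 / 2) := by
        rw [← Real.exp_sum, ← Finset.sum_div, sum_kendallWeight_div_sq hn]

lemma integral_pow_kendallLaw_le {n : ℕ} (hn : 2 ≤ n) (m : ℕ) :
    ∫ y, y ^ (2 * m) ∂(kendallLaw n : Measure ℝ) ≤ (2 * m).factorial * Real.exp (1 / 2) := by
  refine le_trans ?_ (mul_le_mul_of_nonneg_left (integral_cosh_kendallLaw_le hn) (by positivity))
  rw [← integral_const_mul]
  refine integral_mono (integrable_kendallLaw n (by fun_prop))
    (integrable_kendallLaw n (by fun_prop)) fun y => ?_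
  have h := (Real.hasSum_cosh y).summable.le_tsum m fun j _ => by
    have : 0 ≤ y ^ (2 * j) := (even_two_mul j).pow_nonneg y
    positivity
  rw [← Real.cosh_eq_tsum, div_le_iff₀ (by positivity)] at h
  simpa [mul_comm] using h

lemma tendsto_kendallLaw :
    Tendsto kendallLaw atTop (𝓝 (⟨gaussianReal 0 1, inferInstance⟩ : ProbabilityMeasure ℝ)) := by
  refine ProbabilityMeasure.tendsto_iff_tendsto_charFun.2 fun t => ?_
  have hG : charFun (gaussianReal 0 1) t = ((Real.exp (-(t ^ 2 / 2)) : ℝ) : ℂ) := by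
    rw [charFun_gaussianReal]; push_cast; congr 1; simp
  simp only [charFun_kendallLaw, ProbabilityMeasure.coe_mk, hG]
  refine (Complex.continuous_ofReal.tendsto _).comp ?_
  have hlim : Tendsto (fun n : ℕ => t ^ 2 * (6 / (n : ℝ))) atTop (𝓝 0) := by
    simpa using (tendsto_const_div_atTop_nhds_zero_nat (6 : ℝ)).const_mul (t ^ 2)
  rw [tendsto_iff_norm_sub_tendsto_zero]
  refine squeeze_zero' (.of_forall fun _ => norm_nonneg _) ?_
    (by simpa using hlim.mul_const (t ^ 2))
  filter_upwards [eventually_ge_atTop 2, hlim.eventually_le_const zero_lt_one] with n hn hδ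
  have h := abs_prod_cos_sub_exp_le (fun i => t * (kendallWeight n i / kendallSigma n)) hδ
    fun i => by
      rw [mul_pow]
      exact mul_le_mul_of_nonneg_left (kendallWeight_div_sq_le hn i) (sq_nonneg t)
  rw [Real.norm_eq_abs]
  simpa only [mul_pow, ← Finset.mul_sum, sum_kendallWeight_div_sq hn, mul_one] using h

/-- Weak convergence upgrades to convergence of the integral of a nonnegative continuous function
with bounded second moments. -/
lemma tendsto_integral_of_bounded_sq {μs : ℕ → ProbabilityMeasure ℝ} {μ : ProbabilityMeasure ℝ}
    (h : Tendsto μs atTop (𝓝 μ)) {g : ℝ → ℝ} (hg : Continuous g) (hg0 : ∀ y, 0 ≤ g y) {C : ℝ}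
    (hi : ∀ n, Integrable g (μs n : Measure ℝ))
    (hi2 : ∀ n, Integrable (fun y => g y ^ 2) (μs n : Measure ℝ))
    (hμ : Integrable g (μ : Measure ℝ)) (hμ2 : Integrable (fun y => g y ^ 2) (μ : Measure ℝ))
    (hC : ∀ᶠ n in atTop, ∫ y, g y ^ 2 ∂(μs n : Measure ℝ) ≤ C) :
    Tendsto (fun n => ∫ y, g y ∂(μs n : Measure ℝ)) atTop (𝓝 (∫ y, g y ∂(μ : Measure ℝ))) := by
  set D := max C (∫ y, g y ^ 2 ∂(μ : Measure ℝ))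
  have trunc (ν : ProbabilityMeasure ℝ) (h1 : Integrable g (ν : Measure ℝ))
      (h2 : Integrable (fun y => g y ^ 2) (ν : Measure ℝ))
      (hD : ∫ y, g y ^ 2 ∂(ν : Measure ℝ) ≤ D) (M : ℝ) (hM : 0 < M) :
      |∫ y, g y ∂(ν : Measure ℝ) - ∫ y, min (g y) M ∂(ν : Measure ℝ)| ≤ D / M := by
    have h3 : Integrable (fun y => min (g y) M) (ν : Measure ℝ) := h1.inf (integrable_const M)
    rw [← integral_sub h1 h3, abs_of_nonneg (integral_nonneg fun y => by simp)]
    calc ∫ y, (g y - min (g y) M) ∂(ν : Measure ℝ) ≤ ∫ y, g y ^ 2 / M ∂(ν : Measure ℝ) := by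
          refine integral_mono (h1.sub h3) (h2.div_const M) fun y => ?_
          rw [le_div_iff₀ hM]
          rcases le_total (g y) M with hy | hy
          · simp [hy]; positivity
          · simp only [min_eq_right hy]; nlinarith [hg0 y]
      _ ≤ D / M := by rw [integral_div]; gcongr
  have hD0 : 0 ≤ D := (integral_nonneg fun y => sq_nonneg _).trans (le_max_right _ _)
  rw [Metric.tendsto_atTop']
  intro ε hε
  obtain ⟨M, hM, hMε⟩ : ∃ M : ℝ, 0 < M ∧ D / M < ε / 3 := by
    refine ⟨3 * (D + 1) / ε, by positivity, ?_⟩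
    rw [div_lt_iff₀ (by positivity)]
    field_simp
    linarith
  let f : BoundedContinuousFunction ℝ ℝ :=
    BoundedContinuousFunction.ofNormedAddCommGroup (fun y => min (g y) M)
      (hg.min continuous_const) M fun y => by
        rw [Real.norm_eq_abs, abs_of_nonneg (le_min (hg0 y) hM.le)]; exact min_le_right _ _
  have hf := ProbabilityMeasure.tendsto_iff_forall_integral_tendsto.1 h f
  have hf' := Metric.tendsto_nhds.1 hf (ε / 3) (by positivity)
  obtain ⟨N, hN⟩ := eventually_atTop.1 (hf'.and hC)
  refine ⟨N, fun n hn => ?_⟩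
  obtain ⟨ha, hb⟩ := hN n hn.le
  have e1 := trunc (μs n) (hi n) (hi2 n) (hb.trans (le_max_left _ _)) M hM
  have e2 := trunc μ hμ hμ2 (le_max_right _ _) M hM
  have ha' : |∫ y, min (g y) M ∂(μs n : Measure ℝ) - ∫ y, min (g y) M ∂(μ : Measure ℝ)| < ε / 3 :=
    ha
  rw [Real.dist_eq, abs_lt]
  rw [abs_le] at e1 e2
  rw [abs_lt] at ha'
  constructor <;> linarith [e1.1, e1.2, e2.1, e2.2, ha'.1, ha'.2]

lemma integrable_pow_gaussianReal (m : ℕ) :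
    Integrable (fun y : ℝ => y ^ m) (gaussianReal 0 1) := by
  have h := (memLp_id_gaussianReal' (μ := 0) (v := 1) (m : ENNReal) (by simp)).integrable_norm_pow'
  refine h.mono' (by fun_prop) (.of_forall fun y => ?_)
  simp

lemma integral_even_pow_gaussianReal (k : ℕ) :
    ∫ y : ℝ, y ^ (2 * k) ∂gaussianReal 0 1 =
      ((2 * k).factorial : ℝ) / (2 ^ k * (k.factorial : ℝ)) := by
  rw [integral_gaussianReal_eq_integral_smul one_ne_zero]
  have h := integral_comp_abs (f := fun y : ℝ =>
    (√(2 * Real.pi))⁻¹ * (y ^ (2 * k : ℝ) * Real.exp (-(1 / 2) * y ^ (2 : ℝ))))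
  simp only [integral_const_mul] at h
  rw [integral_rpow_mul_exp_neg_mul_rpow (by norm_num)
    (by have : (0 : ℝ) ≤ k := by positivity
        linarith) (by norm_num)] at h
  have e : (2 * (k : ℝ) + 1) / 2 = k + 1 / 2 := by ring
  rw [e, Real.Gamma_nat_add_half] at h
  have e2 : ∀ y : ℝ, gaussianPDFReal 0 1 y • y ^ (2 * k) =
      (√(2 * Real.pi))⁻¹ * (|y| ^ (2 * k : ℝ) * Real.exp (-(1 / 2) * |y| ^ (2 : ℝ))) := by
    intro y
    have e3 : |y| ^ (2 * k : ℝ) = y ^ (2 * k) := by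
      rw [← (even_two_mul k).pow_abs]; exact_mod_cast Real.rpow_natCast |y| (2 * k)
    have e4 : |y| ^ (2 : ℝ) = y ^ 2 := by simp
    rw [e3, e4, gaussianPDFReal_def]
    simp
    ring_nf
  simp only [e2, integral_const_mul]
  rw [h]
  have hdf : (2 * k).factorial = (2 * k - 1).doubleFactorial * (2 ^ k * k.factorial) := by
    rcases k with _ | k
    · simp
    · rw [← Nat.doubleFactorial_two_mul, show 2 * (k + 1) = 2 * k + 1 + 1 by ring,
        Nat.factorial_eq_mul_doubleFactorial, mul_comm, Nat.add_sub_cancel]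
  have hpow : ((1 : ℝ) / 2) ^ (-(2 * (k : ℝ) + 1) / 2) = 2 ^ k * √2 := by
    rw [one_div, Real.inv_rpow zero_le_two, ← Real.rpow_neg zero_le_two, Real.sqrt_eq_rpow,
      ← Real.rpow_natCast, ← Real.rpow_add two_pos]
    congr 1; ring
  rw [hpow, hdf, Real.sqrt_mul zero_le_two]
  push_cast
  field_simp

end KendallLimit

/-- Binary uniform case: standardized even moments tend to (2k)!/(2ᵏ k!) = 1·3·⋯·(2k-1),
odd moments vanish, and S/σ(n) converges in distribution to the standard normal. -/
theorem kendall_asymptotic_normality :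
    (∀ k : ℕ, 1 ≤ k →
      Filter.Tendsto (fun n : ℕ =>
          ((∑ x : Fin n → Fin 2, (kendallS x : ℝ) ^ (2 * k)) / 2 ^ n)
            / kendallSigma n ^ (2 * k))
        Filter.atTop (nhds (((2 * k).factorial : ℝ) / (2 ^ k * (k.factorial : ℝ))))) ∧
    (∀ k n : ℕ, (∑ x : Fin n → Fin 2, (kendallS x : ℝ) ^ (2 * k + 1)) / 2 ^ n = 0) ∧
    (∀ f : BoundedContinuousFunction ℝ ℝ,
      Filter.Tendsto (fun n : ℕ =>
          (∑ x : Fin n → Fin 2, f ((kendallS x : ℝ) / kendallSigma n)) / 2 ^ n)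
        Filter.atTop (nhds (∫ y, f y ∂(ProbabilityTheory.gaussianReal 0 1)))) := by
  refine ⟨fun k _ => ?_, fun k n => by rw [sum_kendallS_odd, zero_div], fun f => ?_⟩
  · rw [← integral_even_pow_gaussianReal]
    have hsq : ∀ y : ℝ, (y ^ (2 * k)) ^ 2 = y ^ (2 * (2 * k)) := fun y => by ring
    have h := tendsto_integral_of_bounded_sq tendsto_kendallLaw
      (g := fun y => y ^ (2 * k)) (C := (2 * (2 * k)).factorial * Real.exp (1 / 2))
      (by fun_prop) (fun y => (even_two_mul k).pow_nonneg y)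
      (fun n => integrable_kendallLaw n (by fun_prop))
      (fun n => integrable_kendallLaw n (by fun_prop))
      (integrable_pow_gaussianReal _)
      (by simp only [hsq]; exact integrable_pow_gaussianReal _)
      (by
        filter_upwards [Filter.eventually_ge_atTop 2] with n hn
        simp only [hsq]
        exact integral_pow_kendallLaw_le hn _)
    refine h.congr fun n => ?_
    rw [integral_kendallLaw n (by fun_prop)]
    simp only [div_pow]
    rw [← Finset.sum_div, smul_eq_mul]
    ring
  · have h := MeasureTheory.ProbabilityMeasure.tendsto_iff_forall_integral_tendsto.1
      tendsto_kendallLaw f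
    refine h.congr fun n => ?_
    rw [integral_kendallLaw n f.continuous, smul_eq_mul]
    ring
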